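/- arXiv:2303.09898 — 2 statements merged into one kernel-verified Lean document; each statement's English description precedes it below -/
import Mathlib

section
/- For all n ≥ 1, the number of edges of the tilde-hypercube satisfies 4·|E(Q̃_n)| = (3n−1)·2^n; equivalently, for all n ≥ 2, |E(Q̃_n)| = (3n−1)·2^{n−2}. -/
/-- One tilde edit step: a replacement (flip one symbol) or a swap of two
adjacent distinct symbols. -/
inductive TStep : List Bool → List Bool → Prop
  | repl (x y : List Bool) (a : Bool) : TStep (x ++ a :: y) (x ++ (!a) :: y)
  | swap (x y : List Bool) (a : Bool) : TStep (x ++ a :: (!a) :: y) (x ++ (!a) :: a :: y)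

/-- `reach step h u v` : `v` can be obtained from `u` by a chain of `h` steps. -/
def reach (step : List Bool → List Bool → Prop) : ℕ → List Bool → List Bool → Prop
  | 0 => Eq
  | h + 1 => fun u v => ∃ w, step u w ∧ reach step h w v

/-- The tilde-distance: the minimum number of replacements and swaps needed to
transform `u` into `v`. -/
noncomputable def tildeDist (u v : List Bool) : ℕ := sInf {h | reach TStep h u v}

theorem TStep.symm {u v : List Bool} (h : TStep u v) : TStep v u := by
  cases h with
  | repl x y a => simpa using TStep.repl x y (!a)
  | swap x y a => simpa using TStep.swap x y (!a)

theorem reach_snoc {step : List Bool → List Bool → Prop} :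
    ∀ {h : ℕ} {u v w : List Bool}, reach step h u v → step v w → reach step (h + 1) u w := by
  intro h
  induction h with
  | zero => intro u v w r s; exact ⟨w, r ▸ s, rfl⟩
  | succ h ih => intro u v w r s; obtain ⟨z, su, rz⟩ := r; exact ⟨z, su, ih rz s⟩

theorem reach_symm : ∀ {h : ℕ} {u v : List Bool}, reach TStep h u v → reach TStep h v u := by
  intro h
  induction h with
  | zero => intro u v r; exact r.symm
  | succ h ih => intro u v r; obtain ⟨w, s, rw⟩ := r; exact reach_snoc (ih rw) s.symm

theorem tildeDist_comm (u v : List Bool) : tildeDist u v = tildeDist v u := by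
  unfold tildeDist
  congr 1
  ext h
  exact ⟨fun r => reach_symm r, fun r => reach_symm r⟩

theorem tildeDist_self (u : List Bool) : tildeDist u u = 0 :=
  Nat.sInf_eq_zero.mpr (Or.inl rfl)

/-- The Hamming distance: the number of positions at which `u` and `v` differ. -/
def hammDist (u v : List Bool) : ℕ := ((u.zip v).filter fun p => p.1 != p.2).length

theorem hammDist_comm : ∀ u v : List Bool, hammDist u v = hammDist v u
  | [], [] => rfl
  | [], _ :: _ => rfl
  | _ :: _, [] => rfl
  | a :: u, b :: v => by
    cases a <;> cases b <;>
      simp [hammDist, List.filter_cons, hammDist_comm u v, hammDist] <;>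
      simpa [hammDist] using hammDist_comm u v

theorem hammDist_self : ∀ u : List Bool, hammDist u u = 0
  | [] => rfl
  | a :: u => by simpa [hammDist, List.filter_cons] using hammDist_self u

/-- Binary words of length `n`. -/
abbrev Word (n : ℕ) := {w : List Bool // w.length = n}

/-- The `n`-tilde-hypercube: vertices are the binary words of length `n`, and
two vertices are adjacent iff their tilde-distance is `1`. -/
noncomputable def tildeCube (n : ℕ) : SimpleGraph (Word n) where
  Adj u v := tildeDist u.val v.val = 1
  symm := ⟨by intro u v h; rwa [tildeDist_comm]⟩
  loopless := ⟨by intro u h; rw [tildeDist_self] at h; exact one_ne_zero h.symm⟩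

/-- The `n`-hypercube: vertices are the binary words of length `n`, and
two vertices are adjacent iff their Hamming distance is `1`. -/
def hamCube (n : ℕ) : SimpleGraph (Word n) where
  Adj u v := hammDist u.val v.val = 1
  symm := ⟨by intro u v h; rwa [hammDist_comm]⟩
  loopless := ⟨by intro u h; rw [hammDist_self] at h; exact one_ne_zero h.symm⟩

/-- `f` is tilde-isometric. -/
def TildeIsometric (f : List Bool) : Prop :=
  ∀ n : ℕ, f.length ≤ n → ∀ u v : List Bool, u.length = n → v.length = n →
    ¬ f <:+: u → ¬ f <:+: v →
    ∃ w : ℕ → List Bool, w 0 = u ∧ w (tildeDist u v) = v ∧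
      (∀ k < tildeDist u v, tildeDist (w k) (w (k + 1)) = 1) ∧
      (∀ k ≤ tildeDist u v, ¬ f <:+: w k)

/-- `f` is Ham-isometric. -/
def HamIsometric (f : List Bool) : Prop :=
  ∀ u v : List Bool, u.length = v.length →
    ¬ f <:+: u → ¬ f <:+: v →
    ∃ w : ℕ → List Bool, w 0 = u ∧ w (hammDist u v) = v ∧
      (∀ k ≤ hammDist u v, (w k).length = u.length) ∧
      (∀ k < hammDist u v, hammDist (w k) (w (k + 1)) = 1) ∧
      (∀ k ≤ hammDist u v, ¬ f <:+: w k)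
/-- The set of words of length `n` avoiding the factor `11`. -/
def fibFree (n : ℕ) : Set (Word n) := {w | ¬ [true, true] <:+: w.val}

/-- The `n`-tilde-Fibonacci cube: the subgraph of the tilde-hypercube induced by
the words avoiding the factor `11`. -/
noncomputable def tildeFibCube (n : ℕ) : SimpleGraph (fibFree n) :=
  (tildeCube n).induce (fibFree n)

/-- The `n`-Fibonacci cube: the subgraph of the hypercube induced by
the words avoiding the factor `11`. -/
def fibCube (n : ℕ) : SimpleGraph (fibFree n) :=
  (hamCube n).induce (fibFree n)

theorem TStep.cons {u v : List Bool} (a : Bool) (h : TStep u v) : TStep (a :: u) (a :: v) := by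
  cases h with
  | repl x y b => exact TStep.repl (a :: x) y b
  | swap x y b => exact TStep.swap (a :: x) y b

theorem TStep.ne {u v : List Bool} (h : TStep u v) : u ≠ v := by
  cases h with
  | repl x y b => cases b <;> simp
  | swap x y b => cases b <;> simp

theorem TStep.length_eq {u v : List Bool} (h : TStep u v) : v.length = u.length := by
  cases h <;> simp

theorem tildeDist_eq_one_iff (u v : List Bool) : tildeDist u v = 1 ↔ TStep u v := by
  unfold tildeDist
  constructor
  · intro h
    have hne : {h | reach TStep h u v}.Nonempty := by
      by_contra hc
      rw [Set.not_nonempty_iff_eq_empty] at hc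
      rw [hc] at h
      simp at h
    have := Nat.sInf_mem hne
    rw [h] at this
    obtain ⟨w, hw, rfl⟩ := this
    exact hw
  · intro h
    have h1 : (1 : ℕ) ∈ {h | reach TStep h u v} := ⟨v, h, rfl⟩
    have h2 := Nat.sInf_le h1
    have h3 : sInf {h | reach TStep h u v} ≠ 0 := by
      intro h0
      rcases Nat.sInf_eq_zero.mp h0 with h4 | h4
      · exact h.ne h4
      · rw [h4] at h1
        exact h1
    omega

/-- swaps at the first position -/
def swapHead (a : Bool) : List Bool → List (List Bool)
  | [] => []
  | b :: y => if a = b then [] else [b :: a :: y]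

/-- all neighbours of a word -/
def nbrs : List Bool → List (List Bool)
  | [] => []
  | a :: w => ((!a) :: w) :: (swapHead a w ++ (nbrs w).map (fun z => a :: z))

theorem mem_swapHead {a : Bool} {w v : List Bool} :
    v ∈ swapHead a w ↔ ∃ y, w = (!a) :: y ∧ v = (!a) :: a :: y := by
  cases w with
  | nil => simp [swapHead]
  | cons b y => cases a <;> cases b <;> simp [swapHead]

theorem mem_nbrs (u v : List Bool) : v ∈ nbrs u ↔ TStep u v := by
  constructor
  · intro h
    induction u generalizing v with
    | nil => simp [nbrs] at h
    | cons a w ih =>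
      simp only [nbrs, List.mem_cons, List.mem_append, List.mem_map, mem_swapHead] at h
      rcases h with rfl | ⟨y, rfl, rfl⟩ | ⟨z, hz, rfl⟩
      · exact TStep.repl [] w a
      · exact TStep.swap [] y a
      · exact (ih z hz).cons a
  · intro h
    cases h with
    | repl x y a =>
      induction x with
      | nil => simp [nbrs]
      | cons b x ih => simp only [List.cons_append, nbrs, List.mem_cons, List.mem_append,
          List.mem_map]; exact Or.inr (Or.inr ⟨_, ih, rfl⟩)
    | swap x y a =>
      induction x with
      | nil => simp [nbrs, mem_swapHead]
      | cons b x ih => simp only [List.cons_append, nbrs, List.mem_cons, List.mem_append,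
          List.mem_map]; exact Or.inr (Or.inr ⟨_, ih, rfl⟩)

theorem nodup_swapHead (a : Bool) (w : List Bool) : (swapHead a w).Nodup := by
  cases w with
  | nil => simp [swapHead]
  | cons b y => cases a <;> cases b <;> simp [swapHead]

theorem nodup_nbrs (u : List Bool) : (nbrs u).Nodup := by
  induction u with
  | nil => simp [nbrs]
  | cons a w ih =>
    simp only [nbrs, List.nodup_cons, List.nodup_append, List.mem_append, List.mem_map,
      mem_swapHead]
    refine ⟨?_, nodup_swapHead a w, ih.map (fun x y h => by simpa using h), ?_⟩
    · rintro (⟨y, rfl, h⟩ | ⟨z, hz, h⟩)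
      · cases a <;> simp at h
      · cases a <;> simp at h
    · rintro _ ⟨y, rfl, rfl⟩ _ ⟨z, hz, rfl⟩ h
      cases a <;> simp at h

noncomputable instance wordFintype (n : ℕ) : Fintype (Word n) :=
  inferInstanceAs (Fintype (List.Vector Bool n))

/-- splitting off the first letter -/
def wordEquiv (n : ℕ) : Word (n + 1) ≃ Bool × Word n where
  toFun w := (w.1.head (by intro h; have := w.2; simp [h] at this), ⟨w.1.tail, by simp [w.2]⟩)
  invFun p := ⟨p.1 :: p.2.1, by simp [p.2.2]⟩
  left_inv w := by simp
  right_inv p := by simp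

theorem sum_word_succ (n : ℕ) (f : List Bool → ℕ) :
    ∑ w : Word (n + 1), f w.1 = ∑ w : Word n, (f (true :: w.1) + f (false :: w.1)) := by
  rw [← Equiv.sum_comp (wordEquiv n).symm, Fintype.sum_prod_type, Fintype.sum_bool,
    ← Finset.sum_add_distrib]
  rfl

theorem card_word (n : ℕ) : Fintype.card (Word n) = 2 ^ n := by
  have : Fintype.card (List.Vector Bool n) = 2 ^ n := by simp
  rw [← this]
  exact Fintype.card_congr (Equiv.refl _)

theorem sum_nbrs (n : ℕ) :
    2 * ∑ w : Word (n + 1), (nbrs w.1).length = (3 * n + 2) * 2 ^ (n + 1) := by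
  induction n with
  | zero =>
    rw [sum_word_succ _ (fun w => (nbrs w).length)]
    have : ∀ w : Word 0, (nbrs (true :: w.1)).length + (nbrs (false :: w.1)).length = 2 := by
      rintro ⟨w, hw⟩
      obtain rfl := List.length_eq_zero_iff.mp hw
      rfl
    simp only [this, Finset.sum_const, Finset.card_univ, card_word]
    norm_num
  | succ n ih =>
    rw [sum_word_succ _ (fun w => (nbrs w).length)]
    have : ∀ w : Word (n + 1), (nbrs (true :: w.1)).length + (nbrs (false :: w.1)).length
        = 3 + 2 * (nbrs w.1).length := by
      rintro ⟨w, hw⟩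
      cases w with
      | nil => simp at hw
      | cons b y => cases b <;> simp [nbrs, swapHead] <;> ring
    simp only [this, Finset.sum_add_distrib, Finset.sum_const, Finset.card_univ, card_word,
      ← Finset.mul_sum, smul_eq_mul]
    rw [mul_add, ← mul_assoc 2 2, mul_assoc 2 2, mul_left_comm, ih]
    ring

open Classical in
theorem degree_eq (n : ℕ) (u : Word n) : (tildeCube n).degree u = (nbrs u.1).length := by
  rw [← List.toFinset_card_of_nodup (nodup_nbrs u.1), ← SimpleGraph.card_neighborFinset_eq_degree,
    ← Finset.card_map (Function.Embedding.subtype _)]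
  congr 1
  ext v
  simp only [Finset.mem_map, SimpleGraph.mem_neighborFinset, List.mem_toFinset, mem_nbrs]
  constructor
  · rintro ⟨w, hw, rfl⟩
    exact (tildeDist_eq_one_iff _ _).mp hw
  · intro h
    exact ⟨⟨v, h.length_eq.trans u.2⟩, (tildeDist_eq_one_iff _ _).mpr h, rfl⟩

theorem four_card (n : ℕ) :
    4 * Nat.card (tildeCube (n + 1)).edgeSet = (3 * n + 2) * 2 ^ (n + 1) := by
  classical
  rw [← sum_nbrs, Nat.card_eq_fintype_card, ← SimpleGraph.edgeFinset_card]
  have := (tildeCube (n + 1)).sum_degrees_eq_twice_card_edges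
  simp only [degree_eq] at this
  rw [this]
  ring

/-- Closed formula for the number of edges of the tilde-hypercube. -/
theorem tildeCube_edge_count :
    (∀ n : ℕ, 1 ≤ n → 4 * Nat.card (tildeCube n).edgeSet = (3 * n - 1) * 2 ^ n) ∧
    (∀ n : ℕ, 2 ≤ n → Nat.card (tildeCube n).edgeSet = (3 * n - 1) * 2 ^ (n - 2)) := by
  constructor
  · intro n hn
    obtain ⟨m, rfl⟩ := Nat.exists_eq_add_of_le' hn
    rw [four_card]
    rfl
  · intro n hn
    obtain ⟨m, rfl⟩ := Nat.exists_eq_add_of_le' hn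
    have h := four_card (m + 1)
    have e : 3 * (m + 2) - 1 = 3 * (m + 1) + 2 := by omega
    rw [e, Nat.add_sub_cancel]
    have : (2 : ℕ) ^ (m + 1 + 1) = 4 * 2 ^ m := by ring
    rw [this, mul_left_comm] at h
    exact Nat.eq_of_mul_eq_mul_left (by norm_num) h
end

section
/- A binary word of length 3 is tilde-isometric if and only if it is neither 101 nor 010. -/
def tD : Option Bool → List Bool → List Bool → ℕ
  | _, [], _ => 0
  | _, _ :: _, [] => 0
  | s, a :: u, b :: v =>
    if a = b then tD none u v
    else if s = some (!a) then tD none u v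
    else 1 + tD (some a) u v

theorem tD_bd (c : Bool) (u v : List Bool) :
    tD (some c) u v ≤ tD none u v ∧ tD none u v ≤ 1 + tD (some c) u v ∧
    tD none u v ≤ 1 + tD (some (!c)) u v ∧ tD (some (!c)) u v ≤ tD none u v := by
  induction u generalizing v c with
  | nil => simp [tD]
  | cons a u ih =>
    cases v with
    | nil => simp [tD]
    | cons b v =>
      have h1 := ih a v
      cases a <;> cases b <;> cases c <;> simp_all [tD] <;> omega

theorem tD_pre (x : List Bool) {u u' v : List Bool}
    (H : ∀ s w, w.length = u.length → tD s u w ≤ tD s u' w + 1) (hv : v.length = (x ++ u).length)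
    (s : Option Bool) :
    tD s (x ++ u) v ≤ tD s (x ++ u') v + 1 := by
  induction x generalizing v s with
  | nil => exact H s v (by simpa using hv)
  | cons a x ih =>
    cases v with
    | nil => simp at hv
    | cons b v =>
      have := fun s => @ih v (by simpa using hv) s
      simp only [tD, List.cons_append]
      split_ifs
      · exact this _
      · exact this _
      · have := this (some a); omega

theorem TStep.len {u v : List Bool} (h : TStep u v) : u.length = v.length := by
  cases h <;> simp

theorem tD_step {u u' v : List Bool} (h : TStep u u') (hv : v.length = u.length) :
    tD none u v ≤ tD none u' v + 1 := by
  cases h with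
  | repl x y a =>
    refine tD_pre x ?_ hv none
    intro s w hw
    match w, hw with
    | b :: w, _ =>
      have := tD_bd a y w
      rcases s with _ | _ | _ <;> cases a <;> cases b <;> simp_all [tD] <;> omega
  | swap x y a =>
    refine tD_pre x ?_ hv none
    intro s w hw
    match w, hw with
    | b :: c :: w, _ =>
      have := tD_bd a y w
      rcases s with _ | _ | _ <;> cases a <;> cases b <;> cases c <;> simp_all [tD] <;> omega

theorem tD_self (s : Option Bool) (u : List Bool) : tD s u u = 0 := by
  induction u generalizing s with
  | nil => simp [tD]
  | cons a u ih => simp [tD, ih]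

theorem tD_le {h : ℕ} {u v : List Bool} (r : reach TStep h u v) :
    u.length = v.length ∧ tD none u v ≤ h := by
  induction h generalizing u with
  | zero => cases r; simp [tD_self]
  | succ h ih =>
    obtain ⟨w, s, r⟩ := r
    have := ih r
    have hl := s.len
    have := tD_step (v := v) s (by omega)
    omega

theorem tD_symm (s : Option Bool) (u v : List Bool) (h : u.length = v.length) :
    tD s u v = tD (s.map not) v u := by
  induction u generalizing s v with
  | nil => cases v <;> simp_all [tD]
  | cons a u ih =>
    cases v with
    | nil => simp at h
    | cons b v =>
      have := fun s => ih s v (by simpa using h)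
      have h1 := this none
      have h2 := this (some a)
      rcases s with _ | _ | _ <;> cases a <;> cases b <;> simp_all [tD]

theorem tD_common (x u v : List Bool) : tD none (x ++ u) (x ++ v) = tD none u v := by
  induction x with
  | nil => rfl
  | cons a x ih => simpa [tD] using ih

def Prog (F : List Bool → Prop) (u v : List Bool) : Prop :=
  ∃ w, F w ∧ ((TStep u w ∧ tD none w v + 1 = tD none u v) ∨
    (TStep v w ∧ tD none u w + 1 = tD none u v))

theorem Prog.symm {F : List Bool → Prop} {u v : List Bool} (hl : u.length = v.length)
    (h : Prog F u v) : Prog F v u := by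
  obtain ⟨w, hw, ⟨s, e⟩ | ⟨s, e⟩⟩ := h
  · refine ⟨w, hw, Or.inr ⟨s, ?_⟩⟩
    have := s.len
    rw [tD_symm _ w v (by omega), tD_symm _ u v hl] at e
    exact e
  · refine ⟨w, hw, Or.inl ⟨s, ?_⟩⟩
    have := s.len
    rw [tD_symm _ u w (by omega), tD_symm _ u v hl] at e
    exact e

theorem decomp (u v : List Bool) (hl : u.length = v.length) (hne : u ≠ v) :
    ∃ x c y z, u = x ++ c :: y ∧ v = x ++ (!c) :: z ∧ y.length = z.length := by
  induction u generalizing v with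
  | nil => cases v <;> simp_all
  | cons a u ih =>
    cases v with
    | nil => simp at hl
    | cons b v =>
      by_cases hab : a = b
      · subst hab
        obtain ⟨x, c, y, z, h1, h2, h3⟩ := ih v (by simpa using hl) (by simpa using hne)
        exact ⟨a :: x, c, y, z, by simp [h1], by simp [h2], h3⟩
      · refine ⟨[], a, u, v, rfl, ?_, by simpa using hl⟩
        cases a <;> cases b <;> simp_all

/-- chain with all words in `F` -/
theorem chain {F : List Bool → Prop}
    (hF : ∀ u v, u.length = v.length → u ≠ v → F u → F v → Prog F u v) (n : ℕ) :
    ∀ u v, u.length = v.length → F u → F v → tD none u v = n →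
      reach (fun a b => TStep a b ∧ F b) n u v := by
  induction n with
  | zero =>
    intro u v hl hu hv hd
    by_contra hne
    obtain ⟨w, -, ⟨-, e⟩ | ⟨-, e⟩⟩ := hF u v hl hne hu hv <;> omega
  | succ n ih =>
    intro u v hl hu hv hd
    have hne : u ≠ v := by rintro rfl; simp [tD_self] at hd
    obtain ⟨w, hw, ⟨s, e⟩ | ⟨s, e⟩⟩ := hF u v hl hne hu hv
    · exact ⟨w, ⟨s, hw⟩, ih w v (by have := s.len; omega) hw hv (by omega)⟩
    · exact reach_snoc (ih u w (by have := s.len; omega) hu hw (by omega)) ⟨s.symm, hv⟩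

theorem flip_or_swap (c : Bool) (x y z : List Bool) :
    (∃ y' z', y = (!c) :: y' ∧ z = c :: z') ∨
    (tD none (x ++ (!c) :: y) (x ++ (!c) :: z) + 1 = tD none (x ++ c :: y) (x ++ (!c) :: z) ∧
     tD none (x ++ c :: y) (x ++ c :: z) + 1 = tD none (x ++ c :: y) (x ++ (!c) :: z)) := by
  simp only [tD_common]
  rcases y with _ | ⟨a, y⟩ <;> rcases z with _ | ⟨b, z⟩
  · right; simp [tD]
  · right; simp [tD]
  · right; simp [tD]
  · cases a <;> cases b <;> cases c <;> simp [tD] <;> omega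

theorem swap_dec (c : Bool) (x y z : List Bool) :
    tD none (x ++ c :: (!c) :: y) (x ++ c :: (!c) :: z) + 1 =
      tD none (x ++ c :: (!c) :: y) (x ++ (!c) :: c :: z) := by
  simp only [tD_common]
  cases c <;> simp [tD] <;> omega

theorem reach_mono {s t : List Bool → List Bool → Prop} (H : ∀ a b, s a b → t a b) {n : ℕ}
    {u v : List Bool} (r : reach s n u v) : reach t n u v := by
  induction n generalizing u with
  | zero => exact r
  | succ n ih => obtain ⟨w, h, r⟩ := r; exact ⟨w, H _ _ h, ih r⟩

theorem tildeDist_eq {u v : List Bool} (hl : u.length = v.length) :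
    tildeDist u v = tD none u v := by
  have r : reach TStep (tD none u v) u v := by
    refine reach_mono (fun a b h => h.1)
      (chain (F := fun _ => True) ?_ _ u v hl trivial trivial rfl)
    intro u v hl hne _ _
    obtain ⟨x, c, y, z, rfl, rfl, h⟩ := decomp u v hl hne
    rcases flip_or_swap c x y z with ⟨y, z, rfl, rfl⟩ | ⟨h1, h2⟩
    · refine ⟨_, trivial, Or.inr ⟨?_, swap_dec c x y z⟩⟩
      simpa using TStep.swap x z (!c)
    · exact ⟨_, trivial, Or.inl ⟨TStep.repl x y c, h1⟩⟩
  apply le_antisymm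
  · exact Nat.sInf_le r
  · exact (tD_le (Nat.sInf_mem (s := {h | reach TStep h u v}) ⟨_, r⟩)).2

theorem len_of_tildeDist {u v : List Bool} (h : tildeDist u v = 1) : u.length = v.length := by
  have : reach TStep (tildeDist u v) u v := by
    apply Nat.sInf_mem (s := {h | reach TStep h u v})
    apply Nat.nonempty_of_pos_sInf
    change 0 < tildeDist u v
    omega
  exact (tD_le this).1

theorem TStep.dist {u v : List Bool} (h : TStep u v) : tildeDist u v = 1 := by
  have r : reach TStep 1 u v := ⟨v, h, rfl⟩
  have h1 : tildeDist u v ≤ 1 := Nat.sInf_le r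
  have h0 : tildeDist u v ≠ 0 := by
    intro e
    have : reach TStep (tildeDist u v) u v := Nat.sInf_mem (s := {h | reach TStep h u v}) ⟨1, r⟩
    rw [e] at this
    have : u = v := this
    cases h <;> simp at this
  omega

theorem seq_of_reach {F : List Bool → Prop} {n : ℕ} {u v : List Bool} (hu : F u)
    (r : reach (fun a b => TStep a b ∧ F b) n u v) :
    ∃ w : ℕ → List Bool, w 0 = u ∧ w n = v ∧ (∀ k < n, tildeDist (w k) (w (k + 1)) = 1) ∧
      (∀ k ≤ n, F (w k)) := by
  induction n generalizing u with
  | zero =>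
    have : u = v := r
    subst this
    exact ⟨fun _ => u, rfl, rfl, by simp, fun _ _ => hu⟩
  | succ n ih =>
    obtain ⟨z, ⟨s, hz⟩, r⟩ := r
    obtain ⟨w, h0, hn, h1, h2⟩ := ih hz r
    refine ⟨fun k => Nat.casesOn k u w, rfl, hn, ?_, ?_⟩
    · rintro (_ | k) hk
      · simpa [h0] using s.dist
      · exact h1 k (by omega)
    · rintro (_ | k) hk
      · exact hu
      · exact h2 k (by omega)

theorem infix_split {a b c : Bool} (x : List Bool) (p q : Bool) (s : List Bool) :
    [a, b, c] <:+: x ++ p :: q :: s ↔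
      [a, b, c] <:+: x ++ [p, q] ∨ [a, b, c] <:+: p :: q :: s := by
  induction x with
  | nil => simp [List.infix_cons_iff]
  | cons d x ih =>
    rw [List.cons_append, List.cons_append, List.infix_cons_iff, ih,
      List.infix_cons_iff (a := d) (l₂ := x ++ [p, q])]
    have : [a, b, c] <+: d :: (x ++ p :: q :: s) ↔ [a, b, c] <+: d :: (x ++ [p, q]) := by
      rcases x with _ | ⟨e, _ | ⟨f, x⟩⟩ <;> simp
    rw [this]; tauto

theorem ends (x : List Bool) : x = [] ∨ (∃ p, x = [p]) ∨ ∃ x' p q, x = x' ++ [p, q] := by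
  rcases List.eq_nil_or_concat x with h | ⟨y, q, rfl⟩
  · exact Or.inl h
  · rcases List.eq_nil_or_concat y with rfl | ⟨z, p, rfl⟩
    · simp
    · exact Or.inr (Or.inr ⟨z, p, q, by simp⟩)

theorem free_swap {c : Bool} {f : List Bool}
    (hf : f = [c, c, c] ∨ f = [c, c, !c] ∨ f = [!c, c, c]) (x y z : List Bool)
    (hu : ¬ f <:+: x ++ c :: (!c) :: y) (hv : ¬ f <:+: x ++ (!c) :: c :: z) :
    ¬ f <:+: x ++ c :: (!c) :: z := by
  rcases ends x with rfl | ⟨p, rfl⟩ | ⟨x, p, q, rfl⟩ <;>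
    simp only [List.append_assoc, List.cons_append, List.nil_append] at * <;>
    rcases hf with rfl | rfl | rfl <;>
    (try rw [infix_split] at hu hv ⊢) <;>
    rcases z with _ | ⟨b, z⟩ <;> cases c <;>
    simp_all [List.infix_cons_iff] <;> grind

theorem free_flip {c : Bool} {f : List Bool}
    (hf : f = [c, c, c] ∨ f = [c, c, !c] ∨ f = [!c, c, c]) (x y z : List Bool)
    (hl : y.length = z.length)
    (hu : ¬ f <:+: x ++ c :: y) (hv : ¬ f <:+: x ++ (!c) :: z) :
    ¬ f <:+: x ++ (!c) :: y ∨ ¬ f <:+: x ++ c :: z := by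
  rcases ends x with rfl | ⟨p, rfl⟩ | ⟨x, p, q, rfl⟩ <;>
    simp only [List.append_assoc, List.cons_append, List.nil_append] at * <;>
    rcases hf with rfl | rfl | rfl <;>
    (try rw [infix_split] at hu hv) <;>
    (try rw [infix_split _ _ _ (_ :: y), infix_split _ _ _ (_ :: z)]) <;>
    rcases y with _ | ⟨a, y⟩ <;> rcases z with _ | ⟨b, z⟩ <;> cases c <;>
    simp_all [List.infix_cons_iff] <;> grind

theorem prog_f {c : Bool} {f : List Bool}
    (hf : f = [c, c, c] ∨ f = [c, c, !c] ∨ f = [!c, c, c]) (u v : List Bool)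
    (hl : u.length = v.length) (hne : u ≠ v) (hu : ¬ f <:+: u) (hv : ¬ f <:+: v) :
    Prog (fun w => ¬ f <:+: w) u v := by
  have key : ∀ x y z, y.length = z.length → ¬ f <:+: x ++ c :: y → ¬ f <:+: x ++ (!c) :: z →
      Prog (fun w => ¬ f <:+: w) (x ++ c :: y) (x ++ (!c) :: z) := by
    intro x y z hl hu hv
    rcases flip_or_swap c x y z with ⟨y, z, rfl, rfl⟩ | ⟨h1, h2⟩
    · refine ⟨_, free_swap hf x y z hu hv, Or.inr ⟨?_, swap_dec c x y z⟩⟩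
      simpa using TStep.swap x z (!c)
    · rcases free_flip hf x y z hl hu hv with h | h
      · exact ⟨_, h, Or.inl ⟨TStep.repl x y c, h1⟩⟩
      · exact ⟨_, h, Or.inr ⟨by simpa using TStep.repl x z (!c), h2⟩⟩
  obtain ⟨x, d, y, z, rfl, rfl, h⟩ := decomp u v hl hne
  by_cases hd : d = c
  · subst hd; exact key x y z h hu hv
  · have : d = !c := by cases c <;> cases d <;> simp_all
    subst this
    rw [Bool.not_not] at *
    exact (key x z y h.symm hv hu).symm (by simp [h])

theorem iso_f {c : Bool} {f : List Bool}
    (hf : f = [c, c, c] ∨ f = [c, c, !c] ∨ f = [!c, c, c]) : TildeIsometric f := by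
  intro n _ u v hu hv hfu hfv
  have hl : u.length = v.length := by omega
  rw [tildeDist_eq hl]
  exact seq_of_reach (F := fun w => ¬ f <:+: w) hfu
    (chain (prog_f hf) _ u v hl hfu hfv rfl)

theorem not_iso (c : Bool) : ¬ TildeIsometric [c, !c, c] := by
  intro H
  obtain ⟨w, h0, h2, h1, hf⟩ := H 4 (by simp) [c, c, c, c] [c, !c, !c, c] rfl rfl
    (by clear H; revert c; decide) (by clear H; revert c; decide)
  have e : tildeDist [c, c, c, c] [c, !c, !c, c] = 2 := by
    rw [tildeDist_eq (by simp)]; clear h0 h2 h1 hf H; revert c; decide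
  rw [e] at h2 h1 hf
  have a := h1 0 (by omega)
  have b := h1 1 (by omega)
  have g := hf 1 (by omega)
  simp only [zero_add, Nat.reduceAdd] at a b
  rw [h0] at a
  rw [h2] at b
  generalize w 1 = t at a b g
  have la := len_of_tildeDist a
  rw [tildeDist_eq la] at a
  rw [tildeDist_eq (len_of_tildeDist b)] at b
  match t, la with
  | [p, q, r, s], _ =>
    clear la e H h0 h2 h1 hf
    revert a b g
    revert c p q r s
    decide

/-- A binary word of length `3` is tilde-isometric iff it is neither `101` nor `010`. -/
theorem tildeIsometric_length_three_iff (f : List Bool) (h : f.length = 3) :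
    TildeIsometric f ↔ f ≠ [true, false, true] ∧ f ≠ [false, true, false] := by
  constructor
  · intro H
    constructor
    · rintro rfl; exact not_iso true H
    · rintro rfl; exact not_iso false H
  · rintro ⟨h1, h2⟩
    match f, h with
    | [a, b, c], _ =>
      refine iso_f (c := b) ?_
      cases a <;> cases b <;> cases c <;> simp_all
end
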